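/- arXiv:2106.14869 — 3 statements merged into one kernel-verified Lean document; each statement's English description precedes it below -/
import Mathlib

section
/- Let G be a finite simple graph and let V_d, V_c be disjoint nonempty vertex subsets such that every vertex of V_d has exactly d neighbors in V_c, where d ≥ 1. Let v_1, v_2, v_3 ∈ V_d be distinct vertices whose neighborhoods in V_c are pairwise distinct sets (i.e., N(v_i) ∩ V_c ≠ N(v_j) ∩ V_c for i ≠ j). Then there exist distinct vertices w_1, w_2, w_3 ∈ V_c with v_r w_r ∈ E(G) for all r ∈ {1,2,3}. Moreover, if {P_1, P_2} is a partition of V_c such that every v ∈ V_d has a neighbor in P_1 and a neighbor in P_2, then w_1, w_2, w_3 can additionally be chosen such that at most two of them lie in P_1 and at most two of them lie in P_2. (This is the 'expand-modulo-twins' claim in the proof of the disjoint-subtrees lemma.) -/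
/-- Three sets, none of which is contained in its cyclic successor, have a system of distinct
representatives. -/
theorem exists_injective_of_cyclic_not_subset {α : Type*} (A : Fin 3 → Set α)
    (h : ∀ r, ¬ A r ⊆ A (r + 1)) :
    ∃ w : Fin 3 → α, Function.Injective w ∧ ∀ r, w r ∈ A r := by
  choose w hw hw' using fun r => Set.not_subset.1 (h r)
  refine ⟨w, fun r r' hrr' => ?_, hw⟩
  by_contra hne
  have hcyc : r' = r + 1 ∨ r = r' + 1 := by lia
  rcases hcyc with rfl | rfl
  · exact hw' r (hrr' ▸ hw (r + 1))
  · exact hw' r' (hrr' ▸ hw (r' + 1))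

/-- If one of three elements lies outside `P`, at most two lie in `P`. -/
theorem ncard_triple_inter_le_two {α : Type*} (w : Fin 3 → α) (P : Set α) (r : Fin 3)
    (hr : w r ∉ P) : (({w 0, w 1, w 2} : Set α) ∩ P).ncard ≤ 2 := by
  have hsub : ({w 0, w 1, w 2} : Set α) ∩ P ⊆ {w (r + 1), w (r + 2)} := by
    rintro x ⟨hx, hxP⟩
    simp only [Set.mem_insert_iff, Set.mem_singleton_iff] at hx ⊢
    fin_cases r <;> rcases hx with rfl | rfl | rfl <;> simp_all
  exact (Set.ncard_le_ncard hsub (Set.toFinite _)).trans ((Set.ncard_insert_le _ _).trans (by simp))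

/-- Let `P` and `Q` be disjoint. If three sets have a system of distinct representatives not
contained in `Q`, and the first set meets `Q`, then they have one with at most two members in
each of `P` and `Q`. -/
theorem exists_injective_ncard_inter_le_two {α : Type*} (A : Fin 3 → Set α) (P Q : Set α)
    (hPQ : Disjoint P Q) (hQ : ∃ x ∈ A 0, x ∈ Q) (w : Fin 3 → α)
    (hinj : Function.Injective w) (hw : ∀ r, w r ∈ A r) (hout : ∃ r, w r ∉ Q) :
    ∃ w : Fin 3 → α, Function.Injective w ∧ (∀ r, w r ∈ A r) ∧
      (({w 0, w 1, w 2} : Set α) ∩ P).ncard ≤ 2 ∧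
      (({w 0, w 1, w 2} : Set α) ∩ Q).ncard ≤ 2 := by
  by_cases hP : ∃ r, w r ∉ P
  · obtain ⟨r, hr⟩ := hP
    obtain ⟨s, hs⟩ := hout
    exact ⟨w, hinj, hw, ncard_triple_inter_le_two w P r hr, ncard_triple_inter_le_two w Q s hs⟩
  · push Not at hP
    obtain ⟨x, hxA, hxQ⟩ := hQ
    have hxP : x ∉ P := hPQ.notMem_of_mem_right hxQ
    have hne : ∀ r, w r ≠ x := fun r hr => hxP (hr ▸ hP r)
    refine ⟨Function.update w 0 x, ?_, ?_, ncard_triple_inter_le_two _ P 0 (by simpa using hxP),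
      ncard_triple_inter_le_two _ Q 1 (by simpa using hPQ.notMem_of_mem_left (hP 1))⟩
    · intro r r' hrr'
      by_cases hr : r = 0 <;> by_cases hr' : r' = 0 <;>
        simp_all [hinj.eq_iff, eq_comm]
    · intro r
      by_cases hr : r = 0 <;> simp_all


theorem stmt6 {V : Type*} [Fintype V] (G : SimpleGraph V) (Vd Vc : Set V)
    (hdisj : Disjoint Vd Vc) (hVd : Vd.Nonempty) (hVc : Vc.Nonempty)
    (d : ℕ) (hd : 1 ≤ d)
    (hdeg : ∀ u ∈ Vd, {w ∈ Vc | G.Adj u w}.ncard = d)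
    (v : Fin 3 → V) (hvmem : ∀ r, v r ∈ Vd) (hvinj : Function.Injective v)
    (htwins : ∀ r r' : Fin 3, r ≠ r' →
      {w ∈ Vc | G.Adj (v r) w} ≠ {w ∈ Vc | G.Adj (v r') w}) :
    (∃ w : Fin 3 → V, Function.Injective w ∧
      ∀ r, w r ∈ Vc ∧ G.Adj (v r) (w r)) ∧
    (∀ P₁ P₂ : Set V, P₁ ∪ P₂ = Vc → Disjoint P₁ P₂ →
      (∀ u ∈ Vd, (∃ w ∈ P₁, G.Adj u w) ∧ (∃ w ∈ P₂, G.Adj u w)) →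
      ∃ w : Fin 3 → V, Function.Injective w ∧
        (∀ r, w r ∈ Vc ∧ G.Adj (v r) (w r)) ∧
        (({w 0, w 1, w 2} : Set V) ∩ P₁).ncard ≤ 2 ∧
        (({w 0, w 1, w 2} : Set V) ∩ P₂).ncard ≤ 2) := by
  have hnot : ∀ r : Fin 3,
      ¬ {w ∈ Vc | G.Adj (v r) w} ⊆ {w ∈ Vc | G.Adj (v (r + 1)) w} := by
    intro r hsub
    refine htwins r (r + 1) (by lia) (Set.eq_of_subset_of_ncard_le hsub ?_ (Set.toFinite _))
    rw [hdeg _ (hvmem r), hdeg _ (hvmem (r + 1))]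
  obtain ⟨w, hinj, hw⟩ := exists_injective_of_cyclic_not_subset _ hnot
  refine ⟨⟨w, hinj, hw⟩, fun P₁ P₂ hP hdis hmeet => ?_⟩
  obtain ⟨⟨x, hx, hvx⟩, ⟨y, hy, hvy⟩⟩ := hmeet _ (hvmem 0)
  by_cases hout : ∃ r, w r ∉ P₂
  · exact exists_injective_ncard_inter_le_two (fun r => {w ∈ Vc | G.Adj (v r) w}) P₁ P₂ hdis
      ⟨y, ⟨hP ▸ Or.inr hy, hvy⟩, hy⟩ w hinj hw hout
  · push Not at hout
    obtain ⟨u, hu, huA, hu₂, hu₁⟩ :=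
      exists_injective_ncard_inter_le_two (fun r => {w ∈ Vc | G.Adj (v r) w}) P₂ P₁ hdis.symm
        ⟨x, ⟨hP ▸ Or.inl hx, hvx⟩, hx⟩ w hinj hw ⟨0, hdis.notMem_of_mem_right (hout 0)⟩
    exact ⟨u, hu, huA, hu₁, hu₂⟩
end

section
/- Let h ≥ 2 and let H be a finite simple graph that has no K_{3,h} minor. Let v_1, v_2, v_3 be distinct pairwise nonadjacent vertices of H such that H − {v_1, v_2, v_3} is connected and nonempty and each v_i has a neighbor in V(H) \ {v_1, v_2, v_3}. Let χ be a 1-stable coloring of H with [v_i]_χ = {v_i} for i = 1, 2, 3. Then there exists a vertex v ∈ V(H) \ {v_1, v_2, v_3} with |[v]_χ| < h. (This is the claim at the start of the proof of the paper's decomposition theorem.) -/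
/-- A vertex coloring is 1-stable for `H`: equally colored vertices have, for every
color `a`, the same number of neighbors of color `a`. -/
def IsOneStable {V C : Type*} (G : SimpleGraph V) (χ : V → C) : Prop :=
  ∀ u v : V, χ u = χ v →
    ∀ a : C, {w : V | G.Adj u w ∧ χ w = a}.ncard = {w : V | G.Adj v w ∧ χ w = a}.ncard

/-- `G` has a `K_{3,h}` minor. -/
def HasK3hMinor {V : Type*} (G : SimpleGraph V) (h : ℕ) : Prop :=
  ∃ (B : Fin 3 → Set V) (D : Fin h → Set V),
    (∀ r, (B r).Nonempty) ∧ (∀ j, (D j).Nonempty) ∧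
    (∀ r, (G.induce (B r)).Connected) ∧ (∀ j, (G.induce (D j)).Connected) ∧
    (∀ r r', r ≠ r' → Disjoint (B r) (B r')) ∧
    (∀ j j', j ≠ j' → Disjoint (D j) (D j')) ∧
    (∀ r j, Disjoint (B r) (D j)) ∧
    (∀ r j, ∃ b ∈ B r, ∃ d ∈ D j, G.Adj b d)

namespace SimpleGraph

/-- The graph of colors, where two distinct colors are adjacent when some edge joins them. -/
def colorQuotient {V C : Type*} (G : SimpleGraph V) (χ : V → C) : SimpleGraph C where
  Adj c d := c ≠ d ∧ ∃ u w, χ u = c ∧ χ w = d ∧ G.Adj u w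
  symm := ⟨fun _ _ ⟨hne, u, w, hu, hw, huw⟩ => ⟨hne.symm, w, u, hw, hu, huw.symm⟩⟩
  loopless := ⟨fun _ h => h.1 rfl⟩

theorem Walk.exists_isPath_first_mem {V : Type*} {G : SimpleGraph V} (P : Set V) {a b : V}
    (q : G.Walk a b) (hb : b ∈ P) :
    ∃ c ∈ P, ∃ w : G.Walk a c, w.IsPath ∧ ∀ z ∈ w.support, z ∈ P → z = c := by
  classical
  suffices h : ∃ c ∈ P, ∃ w : G.Walk a c, ∀ z ∈ w.support, z ∈ P → z = c by
    obtain ⟨c, hc, w, hw⟩ := h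
    exact ⟨c, hc, w.bypass, w.bypass_isPath, fun z hz => hw z (w.support_bypass_subset_support hz)⟩
  induction q with
  | nil => exact ⟨_, hb, .nil, by simp⟩
  | @cons u _ _ hadj q ih =>
    by_cases hu : u ∈ P
    · exact ⟨u, hu, .nil, by simp⟩
    · obtain ⟨c, hc, w, hw⟩ := ih hb
      refine ⟨c, hc, .cons hadj w, fun z hz hzP => ?_⟩
      rw [Walk.support_cons, List.mem_cons] at hz
      rcases hz with rfl | hz
      · exact absurd hzP hu
      · exact hw z hz hzP

/-- Any three vertices of a connected graph are the ends of a subdivided, possibly degenerate,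
star. -/
theorem Preconnected.exists_spider {V : Type*} {G : SimpleGraph V} (hG : G.Preconnected)
    (y : Fin 3 → V) :
    ∃ c, ∃ w : ∀ r, G.Walk c (y r), (∀ r, (w r).IsPath) ∧
      ∀ r r', r ≠ r' → ∀ z ∈ (w r).support, z ∈ (w r').support → z = c := by
  classical
  obtain ⟨p, hp⟩ := (hG (y 0) (y 1)).exists_isPath
  obtain ⟨q⟩ := hG (y 2) (y 0)
  obtain ⟨c, hc, s, hs, hsP⟩ :=
    q.exists_isPath_first_mem {z | z ∈ p.support} p.start_mem_support
  have hc' : c ∈ p.support := hc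
  have key : ∀ z ∈ (p.takeUntil c hc').support, z ∈ (p.dropUntil c hc').support → z = c := by
    intro z h1 h2
    by_contra hne
    have hnd := hp.support_nodup
    rw [← p.take_spec hc', Walk.support_append, List.nodup_append] at hnd
    rw [← Walk.cons_tail_support, List.mem_cons] at h2
    exact hnd.2.2 z h1 z (h2.resolve_left hne) rfl
  have h02 : ∀ z ∈ (p.takeUntil c hc').support, z ∈ s.support → z = c := fun z h1 h2 =>
    hsP z h2 (p.support_takeUntil_subset_support hc' h1)
  have h12 : ∀ z ∈ (p.dropUntil c hc').support, z ∈ s.support → z = c := fun z h1 h2 =>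
    hsP z h2 (p.support_dropUntil_subset_support hc' h1)
  refine ⟨c, Fin.cons (p.takeUntil c hc').reverse
    (Fin.cons (p.dropUntil c hc') (Fin.cons s.reverse (fun i => i.elim0))), ?_, ?_⟩
  · intro r
    fin_cases r
    · exact (hp.takeUntil hc').reverse
    · exact hp.dropUntil hc'
    · exact hs.reverse
  · intro r r' hne z hz hz'
    have e0 : ∀ z ∈ (p.takeUntil c hc').reverse.support, z ∈ (p.takeUntil c hc').support := by simp
    have e2 : ∀ z ∈ s.reverse.support, z ∈ s.support := by simp
    fin_cases r <;> fin_cases r'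
    · exact absurd rfl hne
    · exact key z (e0 z hz) hz'
    · exact h02 z (e0 z hz) (e2 z hz')
    · exact key z (e0 z hz') hz
    · exact absurd rfl hne
    · exact h12 z hz (e2 z hz')
    · exact h02 z (e0 z hz') (e2 z hz)
    · exact h12 z hz' (e2 z hz)
    · exact absurd rfl hne

theorem connected_induce_of_forall_reachable {V : Type*} {G : SimpleGraph V} {B : Set V} {x : V}
    (hx : x ∈ B) (h : ∀ u (hu : u ∈ B), (G.induce B).Reachable ⟨u, hu⟩ ⟨x, hx⟩) :
    (G.induce B).Connected where
  preconnected := fun u u' => (h u u.2).trans (h u' u'.2).symm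
  nonempty := ⟨⟨x, hx⟩⟩

end SimpleGraph

theorem IsOneStable.exists_adj {V C : Type*} [Finite V] {G : SimpleGraph V} {χ : V → C}
    (hχ : IsOneStable G χ) {u u' w : V} (huw : G.Adj u w) (hu : χ u' = χ u) :
    ∃ w', χ w' = χ w ∧ G.Adj u' w' := by
  have hpos : 0 < {x : V | G.Adj u x ∧ χ x = χ w}.ncard :=
    (Set.ncard_pos (Set.toFinite _)).2 ⟨w, huw, rfl⟩
  rw [← hχ u' u hu (χ w)] at hpos
  obtain ⟨w', h1, h2⟩ := (Set.ncard_pos (Set.toFinite _)).1 hpos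
  exact ⟨w', h2, h1⟩

/-- If a vertex of the color of `y` is adjacent to the vertex `x` forming its own color class, then
following a walk of colors ending in `y` leads to `x`. -/
theorem IsOneStable.reachable_of_walk {V C : Type*} [Finite V] {G : SimpleGraph V} {χ : V → C}
    (hχ : IsOneStable G χ) {X : Set C} {x : V} (hx : {w : V | χ w = χ x} = {x}) {B : Set V}
    (hxB : x ∈ B) {z y : X} (q : ((G.colorQuotient χ).induce X).Walk z y)
    {t : V} (ht : χ t = y) (hxt : G.Adj t x)
    (hB : ∀ d ∈ q.support, ∀ u, χ u = d → u ∈ B) {u : V} (hu : χ u = z) (huB : u ∈ B) :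
    (G.induce B).Reachable ⟨u, huB⟩ ⟨x, hxB⟩ := by
  induction q generalizing u with
  | nil =>
    obtain ⟨x', hx', hadj⟩ := hχ.exists_adj hxt (hu.trans ht.symm)
    obtain rfl : x' = x := hx.subset hx'
    exact SimpleGraph.Adj.reachable (G := G.induce B) (by simpa using hadj)
  | cons hadj q ih =>
    obtain ⟨a, b, ha, hb, hab⟩ := hadj.2
    obtain ⟨w, hw, huw⟩ := hχ.exists_adj hab (hu.trans ha.symm)
    have hwB : w ∈ B := hB _ (by simp) w (hw.trans hb)
    have h1 : (G.induce B).Adj ⟨u, huB⟩ ⟨w, hwB⟩ := huw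
    exact h1.reachable.trans
      (ih ht (fun d hd => hB d (by simp [hd])) (hw.trans hb) hwB)

/-- The color classes along a path of colors starting after its first color `c`, together with a
vertex attached to its last color, span a connected set adjacent to every vertex of color `c`. -/
theorem IsOneStable.connected_of_isPath {V C : Type*} [Finite V] {G : SimpleGraph V} {χ : V → C}
    (hχ : IsOneStable G χ) {X : Set C} {x : V} (hx : {w : V | χ w = χ x} = {x})
    {c y : X} {p : ((G.colorQuotient χ).induce X).Walk c y} (hp : p.IsPath)
    {t : V} (ht : χ t = y) (hxt : G.Adj t x) {B : Set V}
    (hB : B = {u | u = x ∨ ∃ d ∈ p.support, d ≠ c ∧ χ u = d}) :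
    (G.induce B).Connected ∧ ∀ u, χ u = c → ∃ b ∈ B, G.Adj b u := by
  classical
  have hxB : x ∈ B := hB ▸ Or.inl rfl
  cases p with
  | nil =>
    have hBx : ∀ u ∈ B, u = x := by
      intro u hu
      rw [hB] at hu
      rcases hu with hu | ⟨d, hd, hdc, -⟩
      · exact hu
      · exact absurd (by simpa using hd) hdc
    refine ⟨SimpleGraph.connected_induce_of_forall_reachable hxB fun u hu => ?_, fun u hu => ?_⟩
    · obtain rfl := hBx u hu
      rfl
    · obtain ⟨x', hx', hadj⟩ := hχ.exists_adj hxt (hu.trans ht.symm)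
      obtain rfl : x' = x := hx.subset hx'
      exact ⟨x', hxB, hadj.symm⟩
  | cons hadj q =>
    rw [SimpleGraph.Walk.cons_isPath_iff] at hp
    have hqB : ∀ d ∈ q.support, ∀ u, χ u = d → u ∈ B := by
      intro d hd u hu
      rw [hB]
      refine Or.inr ⟨d, by simp [hd], ?_, hu⟩
      rintro rfl
      exact hp.2 hd
    refine ⟨SimpleGraph.connected_induce_of_forall_reachable hxB fun u hu => ?_, fun u hu => ?_⟩
    · have hu' := hu
      rw [hB] at hu'
      rcases hu' with rfl | ⟨d, hd, hdc, hud⟩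
      · rfl
      · rw [SimpleGraph.Walk.support_cons, List.mem_cons] at hd
        have hdq := hd.resolve_left hdc
        exact hχ.reachable_of_walk hx hxB (q.dropUntil d hdq) ht hxt
          (fun e he => hqB e (q.support_dropUntil_subset_support hdq he)) hud hu
    · obtain ⟨a, b, ha, hb, hab⟩ := hadj.2
      obtain ⟨w, hw, huw⟩ := hχ.exists_adj hab (hu.trans ha.symm)
      exact ⟨w, hqB _ q.start_mem_support w (hw.trans hb), huw.symm⟩

theorem SimpleGraph.Connected.preconnected_colorQuotient {V C : Type*} {G : SimpleGraph V}
    (χ : V → C) {T : Set V} (hT : (G.induce T).Connected) :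
    ((G.colorQuotient χ).induce (χ '' T)).Preconnected := by
  have key : ∀ {a b : T}, (G.induce T).Walk a b → ((G.colorQuotient χ).induce (χ '' T)).Reachable
      ⟨χ a, Set.mem_image_of_mem χ a.2⟩ ⟨χ b, Set.mem_image_of_mem χ b.2⟩ := by
    intro a b p
    induction p with
    | nil => exact SimpleGraph.Reachable.rfl
    | @cons a a' b hadj p ih =>
      by_cases he : χ a = χ a'
      · simpa only [he] using ih
      · refine SimpleGraph.Reachable.trans (SimpleGraph.Adj.reachable ?_) ih
        exact ⟨he, a, a', rfl, rfl, hadj⟩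
  rintro ⟨_, a, ha, rfl⟩ ⟨_, b, hb, rfl⟩
  obtain ⟨p⟩ := hT.preconnected ⟨a, ha⟩ ⟨b, hb⟩
  exact key p

theorem stmt8 {V C : Type*} [Fintype V] (H : SimpleGraph V) (h : ℕ) (hh : 2 ≤ h)
    (hminor : ¬ HasK3hMinor H h)
    (v : Fin 3 → V) (hvinj : Function.Injective v)
    (hnonadj : ∀ r r' : Fin 3, ¬ H.Adj (v r) (v r'))
    (S : Set V) (hS : S = {v 0, v 1, v 2})
    (hconn : (H.induce Sᶜ).Connected) (hne : Sᶜ.Nonempty)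
    (hnbr : ∀ r : Fin 3, ∃ w ∉ S, H.Adj (v r) w)
    (χ : V → C) (hχ : IsOneStable H χ)
    (hsing : ∀ r : Fin 3, {w : V | χ w = χ (v r)} = {v r}) :
    ∃ u ∉ S, {w : V | χ w = χ u}.ncard < h := by
  by_contra! hbig
  refine hminor ?_
  have hvS : ∀ r, v r ∈ S := by
    intro r
    fin_cases r <;> simp [hS]
  have hSv : ∀ u ∈ S, ∃ r, u = v r := by
    intro u hu
    rw [hS] at hu
    rcases hu with rfl | rfl | rfl <;> exact ⟨_, rfl⟩
  have hcol : ∀ d ∈ χ '' Sᶜ, ∀ u, χ u = d → u ∉ S := by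
    rintro _ ⟨w, hw, rfl⟩ u hu huS
    obtain ⟨r, rfl⟩ := hSv u huS
    obtain rfl : w = v r := (hsing r).subset hu.symm
    exact hw huS
  choose t htS htadj using hnbr
  obtain ⟨c, w, hpath, hdisj⟩ := (hconn.preconnected_colorQuotient χ).exists_spider
    (fun r => ⟨χ (t r), Set.mem_image_of_mem χ (htS r)⟩)
  obtain ⟨u₀, hu₀, hu₀c⟩ := c.2
  have hcard := hbig u₀ hu₀
  rw [hu₀c] at hcard
  obtain ⟨f⟩ : Nonempty (Fin h ↪ {w : V | χ w = c}) := by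
    have := Fintype.ofFinite {w : V | χ w = c}
    refine Function.Embedding.nonempty_of_card_le ?_
    rwa [Fintype.card_fin, ← Nat.card_eq_fintype_card, Nat.card_coe_set_eq]
  let B : Fin 3 → Set V := fun r => {u | u = v r ∨ ∃ d ∈ (w r).support, d ≠ c ∧ χ u = d}
  have hvB : ∀ r, v r ∈ B r := fun r => Or.inl rfl
  have harm : ∀ r, (H.induce (B r)).Connected ∧ ∀ u, χ u = c → ∃ b ∈ B r, H.Adj b u :=
    fun r => hχ.connected_of_isPath (hsing r) (hpath r) rfl (htadj r).symm rfl
  refine ⟨B, fun j => {(f j : V)}, fun r => ⟨_, hvB r⟩, fun j => Set.singleton_nonempty _,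
    fun r => (harm r).1, fun j => ?_, ?_, ?_, ?_, ?_⟩
  · exact SimpleGraph.connected_induce_of_forall_reachable (Set.mem_singleton _) (by
      rintro u rfl
      rfl)
  · intro r r' hr
    rw [Set.disjoint_left]
    rintro u (rfl | ⟨d, hd, hdc, hud⟩) (hu' | ⟨d', hd', hdc', hud'⟩)
    · exact hr (hvinj hu')
    · exact hcol d' d'.2 _ hud' (hvS r)
    · exact hcol d d.2 _ hud (hu' ▸ hvS r')
    · obtain rfl : d = d' := Subtype.ext (hud.symm.trans hud')
      exact hdc (hdisj r r' hr d hd hd')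
  · intro j j' hj
    rw [Set.disjoint_singleton]
    exact fun he => hj (f.injective (Subtype.ext he))
  · intro r j
    rw [Set.disjoint_singleton_right]
    rintro (he | ⟨d, hd, hdc, hud⟩)
    · exact hcol c c.2 _ (f j).2 (he ▸ hvS r)
    · exact hdc (Subtype.ext (hud.symm.trans (f j).2))
  · intro r j
    obtain ⟨b, hb, hadj⟩ := (harm r).2 _ (f j).2
    exact ⟨b, hb, _, rfl, hadj⟩
end

section
/- Let G be a finite simple graph, χ a 2-stable coloring of G, c a vertex color of χ, and let P and Q be two χ-definable partitions of V_c. Then the bipartite intersection graph B with parts P and Q, in which a block P' ∈ P is adjacent to a block Q' ∈ Q iff P' ∩ Q' ≠ ∅, is biregular: there exist numbers d_P and d_Q such that every block of P meets exactly d_P blocks of Q and every block of Q meets exactly d_Q blocks of P. (This is the key intermediate claim in the proof of the partition-overlap lemma.) -/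
/-- A coloring of pairs of vertices is 2-stable for `G`. -/
def IsTwoStable {V C : Type*} (G : SimpleGraph V) (χ : V → V → C) : Prop :=
  ∀ u v u' v' : V, χ u v = χ u' v' →
    (u = v ↔ u' = v') ∧ (G.Adj u v ↔ G.Adj u' v') ∧
    ∀ a b : C, {w : V | χ u w = a ∧ χ w v = b}.ncard =
      {w : V | χ u' w = a ∧ χ w v' = b}.ncard

/-- `P` is a χ-definable partition of the set `Vc`. -/
def IsChiDefinablePartition {V C : Type*} (χ : V → V → C) (Vc : Set V)
    (P : Set (Set V)) : Prop :=
  (∀ p ∈ P, p.Nonempty) ∧ (∀ p ∈ P, p ⊆ Vc) ∧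
  (∀ v ∈ Vc, ∃! p, p ∈ P ∧ v ∈ p) ∧
  ∃ CP : Set C, ∀ v ∈ Vc, ∀ w ∈ Vc, v ≠ w →
    ((∃ p ∈ P, v ∈ p ∧ w ∈ p) ↔ χ v w ∈ CP)

open Classical in
/-- In a 2-stable coloring, the number of vertices reached from `w` by a color in `S` depends only
on the color of `w`. -/
theorem IsTwoStable.ncard_color_mem_eq {V C : Type*} [Fintype V] {G : SimpleGraph V}
    {χ : V → V → C} (hχ : IsTwoStable G χ) {w w' : V} (h : χ w w = χ w' w') (S : Set C) :
    {x | χ w x ∈ S}.ncard = {x | χ w' x ∈ S}.ncard := by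
  have hcount := (hχ w w w' w' h).2.2
  let t : Finset (C × C) :=
    Finset.univ.image (fun x => (χ w x, χ x w)) ∪ Finset.univ.image (fun x => (χ w' x, χ x w'))
  have key : ∀ v, (∀ x, (χ v x, χ x v) ∈ t) → {x | χ v x ∈ S}.ncard =
      ∑ b ∈ t, if b.1 ∈ S then {x | χ v x = b.1 ∧ χ x v = b.2}.ncard else 0 := by
    intro v hv
    rw [Set.ncard_eq_toFinset_card', Finset.card_eq_sum_card_fiberwise
      (f := fun x => (χ v x, χ x v)) (t := t) (fun x _ => hv x)]
    refine Finset.sum_congr rfl fun b _ => ?_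
    split_ifs with hb
    · rw [Set.ncard_eq_toFinset_card']
      congr 1
      ext x
      simp only [Finset.mem_filter, Set.mem_toFinset, Set.mem_ofPred_eq, Prod.ext_iff]
      exact ⟨fun hx => hx.2, fun hx => ⟨hx.1 ▸ hb, hx⟩⟩
    · rw [Finset.card_eq_zero, Finset.filter_eq_empty_iff]
      rintro x hx rfl
      exact hb (by simpa using hx)
  rw [key w fun x => Finset.mem_union_left _ (Finset.mem_image_of_mem _ (Finset.mem_univ x)),
    key w' fun x => Finset.mem_union_right _ (Finset.mem_image_of_mem _ (Finset.mem_univ x))]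
  exact Finset.sum_congr rfl fun b _ => by rw [hcount]

/-- In a 2-stable coloring, the color of a pair determines the color of its second vertex. -/
theorem IsTwoStable.color_right_eq {V C : Type*} [Fintype V] {G : SimpleGraph V}
    {χ : V → V → C} (hχ : IsTwoStable G χ) {v x v' x' : V} (h : χ v x = χ v' x') :
    χ x x = χ x' x' := by
  have hcount := (hχ v x v' x' h).2.2 (χ v x) (χ x x)
  have hpos : 0 < {y | χ v y = χ v x ∧ χ y x = χ x x}.ncard :=
    (Set.ncard_pos (Set.toFinite _)).2 ⟨x, rfl, rfl⟩
  rw [hcount, Set.ncard_pos (Set.toFinite _)] at hpos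
  obtain ⟨y, -, hy⟩ := hpos
  obtain rfl : y = x' := ((hχ y x' x x hy).1).2 rfl
  exact hy.symm

/-- The blocks of a definable partition are the sets of vertices reached from any of their elements
by a color in a fixed set. -/
theorem IsChiDefinablePartition.exists_forall_eq {V C : Type*} [Fintype V] {G : SimpleGraph V}
    {χ : V → V → C} (hχ : IsTwoStable G χ) {c : C} {P : Set (Set V)}
    (hP : IsChiDefinablePartition χ {v : V | χ v v = c} P) :
    ∃ S : Set C, ∀ p ∈ P, ∀ v ∈ p, p = {x | χ v x ∈ S} := by
  obtain ⟨-, hsub, huniq, CP, hCP⟩ := hP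
  refine ⟨{a | ∃ p ∈ P, ∃ v ∈ p, ∃ x ∈ p, χ v x = a}, fun p hp v hv => ?_⟩
  ext x
  refine ⟨fun hx => ⟨p, hp, v, hv, x, hx, rfl⟩, ?_⟩
  rintro ⟨p', hp', v', hv', x', hx', h⟩
  by_cases hvx : v = x
  · exact hvx ▸ hv
  have hvx' : v' ≠ x' := fun e => hvx ((hχ _ _ _ _ h).1.1 e)
  have hx : χ x x = c := (hχ.color_right_eq h).symm.trans (hsub p' hp' hx')
  have hmem : χ v' x' ∈ CP :=
    (hCP v' (hsub p' hp' hv') x' (hsub p' hp' hx') hvx').1 ⟨p', hp', hv', hx'⟩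
  rw [h] at hmem
  obtain ⟨r, hr, hvr, hxr⟩ := (hCP v (hsub p hp hv) x hx hvx).2 hmem
  rwa [(huniq v (hsub p hp hv)).unique ⟨hp, hv⟩ ⟨hr, hvr⟩]

open Classical in
/-- If all blocks of `Q` meeting `p` do so in `k` points, then `p` has `k` times as many points as
there are such blocks. -/
theorem Set.ncard_eq_ncard_inter_nonempty_mul {V : Type*} [Fintype V] {p : Set V}
    {Q : Set (Set V)} {k : ℕ} (hQ : ∀ v ∈ p, ∃! q, q ∈ Q ∧ v ∈ q)
    (hk : ∀ q ∈ Q, (p ∩ q).Nonempty → (p ∩ q).ncard = k) :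
    p.ncard = {q ∈ Q | (p ∩ q).Nonempty}.ncard * k := by
  choose! f hf hf' using hQ
  rw [Set.ncard_eq_toFinset_card' p, Finset.card_eq_sum_card_fiberwise
    (f := f) (t := {q ∈ Q | (p ∩ q).Nonempty}.toFinset), Set.ncard_eq_toFinset_card',
    ← smul_eq_mul, ← Finset.sum_const]
  · refine Finset.sum_congr rfl fun q hq => ?_
    rw [Set.mem_toFinset] at hq
    rw [← hk q hq.1 hq.2, Set.ncard_eq_toFinset_card']
    congr 1
    ext x
    simp only [Finset.mem_filter, Set.mem_toFinset, Set.mem_inter_iff]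
    exact and_congr_right fun hx =>
      ⟨fun e => e ▸ (hf x hx).2, fun hxq => (hf' x hx q ⟨hq.1, hxq⟩).symm⟩
  · intro x hx
    have hx : x ∈ p := by simpa using hx
    simpa using ⟨(hf x hx).1, ⟨x, hx, (hf x hx).2⟩⟩

theorem stmt12 {V C : Type*} [Fintype V] (G : SimpleGraph V) (χ : V → V → C)
    (hχ : IsTwoStable G χ) (c : C) (u₀ : V) (hc : χ u₀ u₀ = c)
    (P Q : Set (Set V))
    (hP : IsChiDefinablePartition χ {v : V | χ v v = c} P)
    (hQ : IsChiDefinablePartition χ {v : V | χ v v = c} Q) :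
    ∃ dP dQ : ℕ,
      (∀ p ∈ P, {q ∈ Q | (p ∩ q).Nonempty}.ncard = dP) ∧
      (∀ q ∈ Q, {p ∈ P | (p ∩ q).Nonempty}.ncard = dQ) := by
  obtain ⟨S, hS⟩ := hP.exists_forall_eq hχ
  obtain ⟨T, hT⟩ := hQ.exists_forall_eq hχ
  have card_block : ∀ {R : Set (Set V)} {U : Set C},
      IsChiDefinablePartition χ {v : V | χ v v = c} R →
      (∀ p ∈ R, ∀ v ∈ p, p = {x | χ v x ∈ U}) →
      ∀ p ∈ R, p.ncard = {x | χ u₀ x ∈ U}.ncard := by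
    intro R U hR hU p hp
    obtain ⟨v, hv⟩ := hR.1 p hp
    rw [hU p hp v hv]
    exact hχ.ncard_color_mem_eq ((hR.2.1 p hp hv).trans hc.symm) U
  have card_inter : ∀ p ∈ P, ∀ q ∈ Q, (p ∩ q).Nonempty →
      (p ∩ q).ncard = {x | χ u₀ x ∈ S ∩ T}.ncard := by
    rintro p hp q hq ⟨v, hvp, hvq⟩
    rw [← hχ.ncard_color_mem_eq ((hP.2.1 p hp hvp).trans hc.symm) (S ∩ T)]
    conv_lhs => rw [hS p hp v hvp, hT q hq v hvq]
    rfl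
  have hpos : 0 < {x | χ u₀ x ∈ S ∩ T}.ncard := by
    obtain ⟨p, ⟨hp, hup⟩, -⟩ := hP.2.2.1 u₀ hc
    obtain ⟨q, ⟨hq, huq⟩, -⟩ := hQ.2.2.1 u₀ hc
    rw [← card_inter p hp q hq ⟨u₀, hup, huq⟩, Set.ncard_pos (Set.toFinite _)]
    exact ⟨u₀, hup, huq⟩
  refine ⟨{x | χ u₀ x ∈ S}.ncard / {x | χ u₀ x ∈ S ∩ T}.ncard,
    {x | χ u₀ x ∈ T}.ncard / {x | χ u₀ x ∈ S ∩ T}.ncard, fun p hp => ?_, fun q hq => ?_⟩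
  · rw [← card_block hP hS p hp, Set.ncard_eq_ncard_inter_nonempty_mul
      (fun v hv => hQ.2.2.1 v (hP.2.1 p hp hv)) (card_inter p hp), Nat.mul_div_cancel _ hpos]
  · simp only [Set.inter_comm _ q]
    rw [← card_block hQ hT q hq, Set.ncard_eq_ncard_inter_nonempty_mul
      (fun v hv => hP.2.2.1 v (hQ.2.1 q hq hv))
      (fun p hp h => by rw [Set.inter_comm] at h ⊢; exact card_inter p hp q hq h),
      Nat.mul_div_cancel _ hpos]
end
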